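/- Consider the complex of graded ℚ-vector spaces Υ₃ associated to the figure eight knot with terms in cohomological degrees −2,…,2 given (after flattening) by block matrices built from m (represented in the basis (X,1) by the 2×4 matrix [[0,1,1,0],[0,0,0,1]]) and Δ (represented by the 4×2 matrix [[1,0],[0,1],[0,1],[0,0]]). Its cohomology is 6-dimensional, with one generator in each of the bidegrees (r,j) = (−2,−5), (−1,−1), (0,−1), (0,1), (1,1), (2,5). -/

import Mathlib

open Matrix

namespace FigureEight

/-- The differential `d⁻² : A₁₁ → A₁₂ ⊕ A₂₁` of the flattened complex `Υ₃`:
the block `M₁` on top of the multiplication matrix `m`. -/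
def d0 : Matrix (Fin 6) (Fin 4) ℚ :=
  !![0, 1, -1, 0;
     0, 0, 0, -1;
     0, 0, 0, 1;
     0, 0, 0, 0;
     0, 1, 1, 0;
     0, 0, 0, 1]

/-- The differential `d⁻¹ : A₁₂ ⊕ A₂₁ → A₁₃ ⊕ A₂₂ ⊕ A₃₁`: two copies of the
multiplication matrix `m = [[0,1,1,0],[0,0,0,1]]` and zeros. -/
def d1 : Matrix (Fin 6) (Fin 6) ℚ :=
  !![0, 1, 1, 0, 0, 0;
     0, 0, 0, 1, 0, 0;
     0, 1, 1, 0, 0, 0;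
     0, 0, 0, 1, 0, 0;
     0, 0, 0, 0, 0, 0;
     0, 0, 0, 0, 0, 0]

/-- The differential `d⁰ : A₁₃ ⊕ A₂₂ ⊕ A₃₁ → A₂₃ ⊕ A₃₂`: the blocks `Δ` and `−Δ`
with `Δ = [[1,0],[0,1],[0,1],[0,0]]`, and zeros. -/
def d2 : Matrix (Fin 6) (Fin 6) ℚ :=
  !![1, 0, -1, 0, 0, 0;
     0, 1, 0, -1, 0, 0;
     0, 1, 0, -1, 0, 0;
     0, 0, 0, 0, 0, 0;
     0, 0, 0, 0, 0, 0;
     0, 0, 0, 0, 0, 0]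

/-- The differential `d¹ : A₂₃ ⊕ A₃₂ → A₃₃`: the blocks `M₂` and `Δ`. -/
def d3 : Matrix (Fin 4) (Fin 6) ℚ :=
  !![0, 1, -1, 0, 1, 0;
     0, 0, 0, -1, 0, 1;
     0, 0, 0, 1, 0, 1;
     0, 0, 0, 0, 0, 0]

/-- The `q`-degrees of the standard basis vectors in cohomological degree `r = −2`:
`A₁₁ = ∅{−5} ⊕ ∅{−3} ⊕ ∅{−3} ⊕ ∅{−1}`. -/
def g0 : Fin 4 → ℤ := ![-5, -3, -3, -1]

/-- The `q`-degrees in cohomological degree `r = −1` (`A₁₂ ⊕ A₂₁`). -/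
def g1 : Fin 6 → ℤ := ![-3, -1, -1, 1, -3, -1]

/-- The `q`-degrees in cohomological degree `r = 0` (`A₁₃ ⊕ A₂₂ ⊕ A₃₁`). -/
def g2 : Fin 6 → ℤ := ![-1, 1, -1, 1, -1, 1]

/-- The `q`-degrees in cohomological degree `r = 1` (`A₂₃ ⊕ A₃₂`). -/
def g3 : Fin 6 → ℤ := ![-1, 1, 1, 3, 1, 3]

/-- The `q`-degrees in cohomological degree `r = 2` (`A₃₃`). -/
def g4 : Fin 4 → ℤ := ![1, 3, 3, 5]

/-- The `q`-degree-`j` graded piece: the span of the standard basis vectors of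
degree `j`. -/
def piece {m : ℕ} (g : Fin m → ℤ) (j : ℤ) : Submodule ℚ (Fin m → ℚ) :=
  Submodule.span ℚ {v | ∃ i, g i = j ∧ v = Pi.single i 1}

/-- The linear maps of the flattened complex `Υ₃`. -/
noncomputable def f0 := Matrix.toLin' d0
noncomputable def f1 := Matrix.toLin' d1
noncomputable def f2 := Matrix.toLin' d2
noncomputable def f3 := Matrix.toLin' d3

theorem mem_piece {m : ℕ} (g : Fin m → ℤ) (j : ℤ) (v : Fin m → ℚ) :
    v ∈ piece g j ↔ ∀ i, g i ≠ j → v i = 0 := by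
  constructor
  · intro h
    unfold piece at h
    induction h using Submodule.span_induction with
    | mem x hx =>
      obtain ⟨i, hi, rfl⟩ := hx
      intro k hk
      have : k ≠ i := by rintro rfl; exact hk hi
      simp [this]
    | zero => simp
    | add x y _ _ hx hy => intro i hi; simp [hx i hi, hy i hi]
    | smul a x _ hx => intro i hi; simp [hx i hi]
  · intro h
    rw [pi_eq_sum_univ' v]
    refine Submodule.sum_mem _ fun i _ => ?_
    by_cases hi : g i = j
    · refine Submodule.smul_mem _ _ (Submodule.subset_span ⟨i, hi, ?_⟩)
      ext k
      simp [Pi.single_apply, eq_comm]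
    · simp [h i hi]

theorem finrank_quot {V W : Type*} [AddCommGroup V] [Module ℚ V] [AddCommGroup W] [Module ℚ W]
    (K R : Submodule ℚ V) (φ : V →ₗ[ℚ] W) (h : ∀ x ∈ K, x ∈ R ↔ φ x = 0)
    (hs : ∀ c, ∃ x ∈ K, φ x = c) :
    Module.finrank ℚ (K ⧸ Submodule.comap K.subtype R) = Module.finrank ℚ W := by
  have e : Submodule.comap K.subtype R = LinearMap.ker (φ ∘ₗ K.subtype) := by
    ext ⟨x, hx⟩
    simpa using h x hx
  rw [e]
  refine ((φ ∘ₗ K.subtype).quotKerEquivOfSurjective ?_).finrank_eq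
  intro c
  obtain ⟨x, hx, rfl⟩ := hs c
  exact ⟨⟨x, hx⟩, rfl⟩

theorem finrank_quot_zero {V : Type*} [AddCommGroup V] [Module ℚ V]
    (K R : Submodule ℚ V) (h : ∀ x ∈ K, x ∈ R) :
    Module.finrank ℚ (K ⧸ Submodule.comap K.subtype R) = 0 := by
  have e := finrank_quot K R (0 : V →ₗ[ℚ] (Fin 0 → ℚ)) (fun x hx => by simp [h x hx])
    (fun c => ⟨0, K.zero_mem, Subsingleton.elim _ _⟩)
  simpa using e

theorem finrank_sub {V W : Type*} [AddCommGroup V] [Module ℚ V] [AddCommGroup W] [Module ℚ W]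
    (K : Submodule ℚ V) (φ : V →ₗ[ℚ] W) (h : ∀ x ∈ K, φ x = 0 → x = 0)
    (hs : ∀ c, ∃ x ∈ K, φ x = c) :
    Module.finrank ℚ K = Module.finrank ℚ W := by
  refine (LinearEquiv.ofBijective (φ ∘ₗ K.subtype) ⟨?_, ?_⟩).finrank_eq
  · rw [← LinearMap.ker_eq_bot, LinearMap.ker_eq_bot']
    rintro ⟨x, hx⟩ h0
    exact Subtype.ext (h x hx h0)
  · intro c
    obtain ⟨x, hx, rfl⟩ := hs c
    exact ⟨⟨x, hx⟩, rfl⟩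

theorem f0_apply (v : Fin 4 → ℚ) :
    f0 v = ![v 1 - v 2, -v 3, v 3, 0, v 1 + v 2, v 3] := by
  ext i
  fin_cases i <;>
    simp [f0, d0, Matrix.mulVec, dotProduct, Fin.sum_univ_succ] <;> ring

theorem f1_apply (v : Fin 6 → ℚ) :
    f1 v = ![v 1 + v 2, v 3, v 1 + v 2, v 3, 0, 0] := by
  ext i
  fin_cases i <;>
    simp [f1, d1, Matrix.mulVec, dotProduct, Fin.sum_univ_succ]

theorem f2_apply (v : Fin 6 → ℚ) :
    f2 v = ![v 0 - v 2, v 1 - v 3, v 1 - v 3, 0, 0, 0] := by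
  ext i
  fin_cases i <;>
    simp [f2, d2, Matrix.mulVec, dotProduct, Fin.sum_univ_succ] <;> ring

theorem f3_apply (v : Fin 6 → ℚ) :
    f3 v = ![v 1 - v 2 + v 4, v 5 - v 3, v 3 + v 5, 0] := by
  ext i
  fin_cases i <;>
    simp [f3, d3, Matrix.mulVec, dotProduct, Fin.sum_univ_succ] <;> ring

theorem all4 (P : Fin 4 → Prop) : (∀ i, P i) ↔ P 0 ∧ P 1 ∧ P 2 ∧ P 3 := by
  constructor
  · intro h; exact ⟨h 0, h 1, h 2, h 3⟩
  · rintro ⟨a, b, c, d⟩ i; fin_cases i <;> assumption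

theorem all6 (P : Fin 6 → Prop) : (∀ i, P i) ↔ P 0 ∧ P 1 ∧ P 2 ∧ P 3 ∧ P 4 ∧ P 5 := by
  constructor
  · intro h; exact ⟨h 0, h 1, h 2, h 3, h 4, h 5⟩
  · rintro ⟨a, b, c, d, e, f⟩ i; fin_cases i <;> assumption

theorem ker0 (v : Fin 4 → ℚ) : v ∈ LinearMap.ker f0 ↔ v 1 = 0 ∧ v 2 = 0 ∧ v 3 = 0 := by
  simp only [LinearMap.mem_ker, f0_apply, funext_iff, all6]
  simp
  grind

theorem ker1 (v : Fin 6 → ℚ) : v ∈ LinearMap.ker f1 ↔ v 1 + v 2 = 0 ∧ v 3 = 0 := by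
  simp only [LinearMap.mem_ker, f1_apply, funext_iff, all6]
  simp
  grind

theorem ker2 (v : Fin 6 → ℚ) : v ∈ LinearMap.ker f2 ↔ v 0 = v 2 ∧ v 1 = v 3 := by
  simp only [LinearMap.mem_ker, f2_apply, funext_iff, all6]
  simp
  grind

theorem ker3 (v : Fin 6 → ℚ) :
    v ∈ LinearMap.ker f3 ↔ v 1 - v 2 + v 4 = 0 ∧ v 3 = 0 ∧ v 5 = 0 := by
  simp only [LinearMap.mem_ker, f3_apply, funext_iff, all4]
  simp
  grind

theorem range0 (v : Fin 6 → ℚ) :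
    v ∈ LinearMap.range f0 ↔ v 1 = -v 5 ∧ v 2 = v 5 ∧ v 3 = 0 := by
  constructor
  · rintro ⟨w, rfl⟩
    simp [f0_apply]
  · rintro ⟨h1, h2, h3⟩
    refine ⟨![0, (v 0 + v 4) / 2, (v 4 - v 0) / 2, v 5], ?_⟩
    simp only [f0_apply, funext_iff, all6]
    simp
    grind

theorem range1 (v : Fin 6 → ℚ) :
    v ∈ LinearMap.range f1 ↔ v 0 = v 2 ∧ v 1 = v 3 ∧ v 4 = 0 ∧ v 5 = 0 := by
  constructor
  · rintro ⟨w, rfl⟩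
    simp [f1_apply]
  · rintro ⟨h1, h2, h3, h4⟩
    refine ⟨![0, v 0, 0, v 1, 0, 0], ?_⟩
    simp only [f1_apply, funext_iff, all6]
    simp
    grind

theorem range2 (v : Fin 6 → ℚ) :
    v ∈ LinearMap.range f2 ↔ v 1 = v 2 ∧ v 3 = 0 ∧ v 4 = 0 ∧ v 5 = 0 := by
  constructor
  · rintro ⟨w, rfl⟩
    simp [f2_apply]
  · rintro ⟨h1, h2, h3, h4⟩
    refine ⟨![v 0, v 1, 0, 0, 0, 0], ?_⟩
    simp only [f2_apply, funext_iff, all6]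
    simp
    grind

theorem range3 (v : Fin 4 → ℚ) :
    v ∈ LinearMap.range f3 ↔ v 3 = 0 := by
  constructor
  · rintro ⟨w, rfl⟩
    simp [f3_apply]
  · intro h
    refine ⟨![0, v 0, 0, (v 2 - v 1) / 2, 0, (v 2 + v 1) / 2], ?_⟩
    simp only [f3_apply, funext_iff, all4]
    simp
    grind

theorem p0 (j : ℤ) (v : Fin 4 → ℚ) : v ∈ piece g0 j ↔ (-5 ≠ j → v 0 = 0) ∧ (-3 ≠ j → v 1 = 0) ∧
    (-3 ≠ j → v 2 = 0) ∧ (-1 ≠ j → v 3 = 0) := by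
  rw [mem_piece, all4]; rfl

theorem p1 (j : ℤ) (v : Fin 6 → ℚ) : v ∈ piece g1 j ↔ (-3 ≠ j → v 0 = 0) ∧ (-1 ≠ j → v 1 = 0) ∧
    (-1 ≠ j → v 2 = 0) ∧ (1 ≠ j → v 3 = 0) ∧ (-3 ≠ j → v 4 = 0) ∧ (-1 ≠ j → v 5 = 0) := by
  rw [mem_piece, all6]; rfl

theorem p2 (j : ℤ) (v : Fin 6 → ℚ) : v ∈ piece g2 j ↔ (-1 ≠ j → v 0 = 0) ∧ (1 ≠ j → v 1 = 0) ∧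
    (-1 ≠ j → v 2 = 0) ∧ (1 ≠ j → v 3 = 0) ∧ (-1 ≠ j → v 4 = 0) ∧ (1 ≠ j → v 5 = 0) := by
  rw [mem_piece, all6]; rfl

theorem p3 (j : ℤ) (v : Fin 6 → ℚ) : v ∈ piece g3 j ↔ (-1 ≠ j → v 0 = 0) ∧ (1 ≠ j → v 1 = 0) ∧
    (1 ≠ j → v 2 = 0) ∧ (3 ≠ j → v 3 = 0) ∧ (1 ≠ j → v 4 = 0) ∧ (3 ≠ j → v 5 = 0) := by
  rw [mem_piece, all6]; rfl

theorem p4 (j : ℤ) (v : Fin 4 → ℚ) : v ∈ piece g4 j ↔ (1 ≠ j → v 0 = 0) ∧ (3 ≠ j → v 1 = 0) ∧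
    (3 ≠ j → v 2 = 0) ∧ (5 ≠ j → v 3 = 0) := by
  rw [mem_piece, all4]; rfl

/-- Coordinate functionals. -/
def co (n : ℕ) (i : Fin n) : (Fin n → ℚ) →ₗ[ℚ] ℚ := LinearMap.proj i

theorem co_apply (n : ℕ) (i : Fin n) (v : Fin n → ℚ) : co n i v = v i := rfl

/-- The cohomology of the complex `Υ₃` of graded vector spaces computing the
Khovanov homology of the figure eight knot is six-dimensional, with exactly one
generator in each of the bidegrees
`(−2,−5)`, `(−1,−1)`, `(0,−1)`, `(0,1)`, `(1,1)`, `(2,5)`: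
both the total cohomology in each cohomological degree `r` and each of its
`q`-graded pieces have the indicated dimensions.  (`Υ₃` is indeed a complex:
consecutive differentials compose to zero, and they preserve the `q`-grading.) -/
theorem figure_eight_khovanov_homology :
    (f1 ∘ₗ f0 = 0 ∧ f2 ∘ₗ f1 = 0 ∧ f3 ∘ₗ f2 = 0) ∧
    (∀ j : ℤ,
      Submodule.map f0 (piece g0 j) ≤ piece g1 j ∧
      Submodule.map f1 (piece g1 j) ≤ piece g2 j ∧
      Submodule.map f2 (piece g2 j) ≤ piece g3 j ∧
      Submodule.map f3 (piece g3 j) ≤ piece g4 j) ∧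
    -- total cohomology: dimensions 1, 1, 2, 1, 1 (six-dimensional in all)
    (Module.finrank ℚ (LinearMap.ker f0) = 1 ∧
     Module.finrank ℚ
       ((LinearMap.ker f1) ⧸
         Submodule.comap (LinearMap.ker f1).subtype (LinearMap.range f0)) = 1 ∧
     Module.finrank ℚ
       ((LinearMap.ker f2) ⧸
         Submodule.comap (LinearMap.ker f2).subtype (LinearMap.range f1)) = 2 ∧
     Module.finrank ℚ
       ((LinearMap.ker f3) ⧸
         Submodule.comap (LinearMap.ker f3).subtype (LinearMap.range f2)) = 1 ∧
     Module.finrank ℚ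
       ((⊤ : Submodule ℚ (Fin 4 → ℚ)) ⧸
         Submodule.comap (⊤ : Submodule ℚ (Fin 4 → ℚ)).subtype (LinearMap.range f3))
       = 1) ∧
    -- graded pieces: one generator in each listed bidegree (r, j)
    (∀ j : ℤ,
      Module.finrank ℚ ↥(LinearMap.ker f0 ⊓ piece g0 j) =
        (if j = -5 then 1 else 0) ∧
      Module.finrank ℚ
        (↥(LinearMap.ker f1 ⊓ piece g1 j) ⧸
          Submodule.comap (LinearMap.ker f1 ⊓ piece g1 j).subtype
            (LinearMap.range f0)) = (if j = -1 then 1 else 0) ∧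
      Module.finrank ℚ
        (↥(LinearMap.ker f2 ⊓ piece g2 j) ⧸
          Submodule.comap (LinearMap.ker f2 ⊓ piece g2 j).subtype
            (LinearMap.range f1)) = (if j = -1 ∨ j = 1 then 1 else 0) ∧
      Module.finrank ℚ
        (↥(LinearMap.ker f3 ⊓ piece g3 j) ⧸
          Submodule.comap (LinearMap.ker f3 ⊓ piece g3 j).subtype
            (LinearMap.range f2)) = (if j = 1 then 1 else 0) ∧
      Module.finrank ℚ
        ((piece g4 j) ⧸
          Submodule.comap (piece g4 j).subtype (LinearMap.range f3)) =
        (if j = 5 then 1 else 0)) := by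
  refine ⟨⟨?_, ?_, ?_⟩, fun j => ⟨?_, ?_, ?_, ?_⟩, ⟨?_, ?_, ?_, ?_, ?_⟩,
    fun j => ⟨?_, ?_, ?_, ?_, ?_⟩⟩
  · refine LinearMap.ext fun v => ?_
    simp only [LinearMap.comp_apply, f0_apply, f1_apply, funext_iff, all6]
    simp
  · refine LinearMap.ext fun v => ?_
    simp only [LinearMap.comp_apply, f1_apply, f2_apply, funext_iff, all6]
    simp
  · refine LinearMap.ext fun v => ?_
    simp only [LinearMap.comp_apply, f2_apply, f3_apply, funext_iff, all4]
    simp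
  · rintro _ ⟨v, hv, rfl⟩
    rw [SetLike.mem_coe, p0] at hv
    rw [p1, f0_apply]
    simp
    grind
  · rintro _ ⟨v, hv, rfl⟩
    rw [SetLike.mem_coe, p1] at hv
    rw [p2, f1_apply]
    simp
    grind
  · rintro _ ⟨v, hv, rfl⟩
    rw [SetLike.mem_coe, p2] at hv
    rw [p3, f2_apply]
    simp
    grind
  · rintro _ ⟨v, hv, rfl⟩
    rw [SetLike.mem_coe, p3] at hv
    rw [p4, f3_apply]
    simp
    grind
  · exact (finrank_sub _ (co 4 0)
              (fun x hx h => by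
                simp only [Submodule.mem_inf, ker0, co_apply] at hx h
                simp only [funext_iff, all4, Pi.zero_apply]
                grind)
              (fun c => ⟨![c, 0, 0, 0], by simp only [Submodule.mem_inf, ker0]; simp, by simp [co_apply]⟩)).trans
                (Module.finrank_self ℚ)
  · exact (finrank_quot _ _ (co 6 1 + co 6 5)
              (fun x hx => by
                simp only [Submodule.mem_inf, Submodule.mem_top, ker1, range0, co_apply, LinearMap.add_apply] at hx ⊢
                grind)
              (fun c => ⟨![0, 0, 0, 0, 0, c], by
                simp only [Submodule.mem_inf, ker1]; simp, by simp [co_apply]⟩)).trans (Module.finrank_self ℚ)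
  · refine (finrank_quot _ _ ((co 6 4).prod (co 6 5))
      (fun x hx => by
        simp only [ker2, range1, co_apply, LinearMap.prod_apply, Function.prod_apply, Prod.mk_eq_zero] at hx ⊢
        grind)
      (fun c => ⟨![0, 0, 0, 0, c.1, c.2], by
        simp only [ker2]; simp, by simp [co_apply]⟩)).trans ?_
    simp
  · exact (finrank_quot _ _ (co 6 4)
              (fun x hx => by
                simp only [Submodule.mem_inf, Submodule.mem_top, ker3, range2, co_apply, LinearMap.add_apply] at hx ⊢
                grind)
              (fun c => ⟨![0, 0, c, 0, c, 0], by
                simp only [Submodule.mem_inf, ker3]; simp, by simp [co_apply]⟩)).trans (Module.finrank_self ℚ)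
  · exact (finrank_quot _ _ (co 4 3)
              (fun x hx => by
                simp only [Submodule.mem_inf, Submodule.mem_top, Submodule.mem_top, range3, co_apply, LinearMap.add_apply] at hx ⊢
                )
              (fun c => ⟨![0, 0, 0, c], by
                simp , by simp [co_apply]⟩)).trans (Module.finrank_self ℚ)
  · split_ifs with h
    · subst h
      exact (finrank_sub _ (co 4 0)
              (fun x hx h => by
                simp only [Submodule.mem_inf, ker0, p0, co_apply] at hx h
                simp only [funext_iff, all4, Pi.zero_apply]
                grind)
              (fun c => ⟨![c, 0, 0, 0], by simp only [Submodule.mem_inf, ker0, p0]; simp, by simp [co_apply]⟩)).trans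
                (Module.finrank_self ℚ)
    · exact (finrank_sub _ (0 : _ →ₗ[ℚ] (Fin 0 → ℚ))
        (fun x hx _ => by
          simp only [Submodule.mem_inf, ker0, p0] at hx
          simp only [funext_iff, all4, Pi.zero_apply]
          grind)
        (fun c => ⟨0, Submodule.zero_mem _, Subsingleton.elim _ _⟩)).trans (by simp)
  · split_ifs with h
    · subst h
      exact (finrank_quot _ _ (co 6 1 + co 6 5)
              (fun x hx => by
                simp only [Submodule.mem_inf, Submodule.mem_top, ker1, p1, range0, co_apply, LinearMap.add_apply] at hx ⊢
                grind)
              (fun c => ⟨![0, 0, 0, 0, 0, c], by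
                simp only [Submodule.mem_inf, ker1, p1]; simp, by simp [co_apply]⟩)).trans (Module.finrank_self ℚ)
    · exact finrank_quot_zero _ _ (fun x hx => by
                simp only [Submodule.mem_inf, ker1, p1, range0] at hx ⊢
                grind)
  · split_ifs with h
    · rcases h with rfl | rfl
      · exact (finrank_quot _ _ (co 6 4)
              (fun x hx => by
                simp only [Submodule.mem_inf, Submodule.mem_top, ker2, p2, range1, co_apply, LinearMap.add_apply] at hx ⊢
                grind)
              (fun c => ⟨![0, 0, 0, 0, c, 0], by
                simp only [Submodule.mem_inf, ker2, p2]; simp, by simp [co_apply]⟩)).trans (Module.finrank_self ℚ)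
      · exact (finrank_quot _ _ (co 6 5)
              (fun x hx => by
                simp only [Submodule.mem_inf, Submodule.mem_top, ker2, p2, range1, co_apply, LinearMap.add_apply] at hx ⊢
                grind)
              (fun c => ⟨![0, 0, 0, 0, 0, c], by
                simp only [Submodule.mem_inf, ker2, p2]; simp, by simp [co_apply]⟩)).trans (Module.finrank_self ℚ)
    · exact finrank_quot_zero _ _ (fun x hx => by
                simp only [Submodule.mem_inf, ker2, p2, range1] at hx ⊢
                grind)
  · split_ifs with h
    · subst h
      exact (finrank_quot _ _ (co 6 4)
              (fun x hx => by
                simp only [Submodule.mem_inf, Submodule.mem_top, ker3, p3, range2, co_apply, LinearMap.add_apply] at hx ⊢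
                grind)
              (fun c => ⟨![0, 0, c, 0, c, 0], by
                simp only [Submodule.mem_inf, ker3, p3]; simp, by simp [co_apply]⟩)).trans (Module.finrank_self ℚ)
    · exact finrank_quot_zero _ _ (fun x hx => by
                simp only [Submodule.mem_inf, ker3, p3, range2] at hx ⊢
                grind)
  · split_ifs with h
    · subst h
      exact (finrank_quot _ _ (co 4 3)
              (fun x hx => by
                simp only [Submodule.mem_inf, Submodule.mem_top, p4, range3, co_apply, LinearMap.add_apply] at hx ⊢)
              (fun c => ⟨![0, 0, 0, c], by
                simp only [Submodule.mem_inf, p4]; simp, by simp [co_apply]⟩)).trans (Module.finrank_self ℚ)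
    · exact finrank_quot_zero _ _ (fun x hx => by
                simp only [Submodule.mem_inf, p4, range3] at hx ⊢
                grind)

end FigureEight
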